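/- Let C, D, D' be categories, let F : C ⥤ D be left adjoint to G : D ⥤ C, let F' : C ⥤ D' be left adjoint to G' : D' ⥤ C, and suppose there is an isomorphism of monads σ : G ∘ F ≅ G' ∘ F' (an isomorphism in the category of monads on C, i.e. compatible with the adjunction units and the multiplications G ε F and G' ε' F'). Then for every object X of C there is an isomorphism of monoids End_D(F X) ≅ End_{D'}(F' X) between the endomorphism monoids under composition. -/

import Mathlib

open CategoryTheory

namespace CategoryTheory.Adjunction

variable {C D D' : Type*} [Category C] [Category D] [Category D']
  {F : C ⥤ D} {G : D ⥤ C} {F' : C ⥤ D'} {G' : D' ⥤ C}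

/-- Composition in the Kleisli category of the adjunction monad corresponds to composition
in the target of the left adjoint. -/
theorem homEquiv_comp_eq_kleisli (adj : F ⊣ G) {X Y Z : C}
    (f : F.obj X ⟶ F.obj Y) (g : F.obj Y ⟶ F.obj Z) :
    adj.homEquiv X (F.obj Z) (f ≫ g) =
      adj.homEquiv X (F.obj Y) f ≫ G.map (F.map (adj.homEquiv Y (F.obj Z) g)) ≫
        G.map (adj.counit.app (F.obj Z)) := by
  rw [adj.homEquiv_naturality_right, ← G.map_comp, ← adj.homEquiv_counit (g := adj.homEquiv Y _ g),
    Equiv.symm_apply_apply]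

/-- An isomorphism of adjunction monads identifies the morphisms between objects in the images
of the left adjoints. -/
def homEquivOfMonadIso (adj : F ⊣ G) (adj' : F' ⊣ G') (σ : adj.toMonad ≅ adj'.toMonad)
    (X Y : C) : (F.obj X ⟶ F.obj Y) ≃ (F'.obj X ⟶ F'.obj Y) :=
  (adj.homEquiv X (F.obj Y)).trans <|
    (Iso.homToEquiv ((MonadIso.toNatIso σ).app Y : G.obj (F.obj Y) ≅ G'.obj (F'.obj Y))).trans
      (adj'.homEquiv X (F'.obj Y)).symm

theorem homEquivOfMonadIso_comp (adj : F ⊣ G) (adj' : F' ⊣ G')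
    (σ : adj.toMonad ≅ adj'.toMonad) {X Y Z : C}
    (f : F.obj X ⟶ F.obj Y) (g : F.obj Y ⟶ F.obj Z) :
    homEquivOfMonadIso adj adj' σ X Z (f ≫ g) =
      homEquivOfMonadIso adj adj' σ X Y f ≫ homEquivOfMonadIso adj adj' σ Y Z g := by
  obtain ⟨s, hn, hμ, hs⟩ : ∃ s : ∀ A, G.obj (F.obj A) ⟶ G'.obj (F'.obj A),
      (∀ {A B : C} (h : A ⟶ B), G.map (F.map h) ≫ s B = s A ≫ G'.map (F'.map h)) ∧
      (∀ A, G.map (adj.counit.app (F.obj A)) ≫ s A =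
        (G.map (F.map (s A)) ≫ s (G'.obj (F'.obj A))) ≫ G'.map (adj'.counit.app (F'.obj A))) ∧
      ∀ {A B : C} (h : F.obj A ⟶ F.obj B),
        adj'.homEquiv A (F'.obj B) (homEquivOfMonadIso adj adj' σ A B h) =
          adj.homEquiv A (F.obj B) h ≫ s B :=
    ⟨fun A => σ.hom.app A, fun h => σ.hom.naturality h, fun A => σ.hom.app_μ A,
      fun _ => Equiv.apply_symm_apply _ _⟩
  apply (adj'.homEquiv X (F'.obj Z)).injective
  rw [hs, homEquiv_comp_eq_kleisli, homEquiv_comp_eq_kleisli, hs, hs]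
  simp only [Category.assoc, hμ, Functor.map_comp, reassoc_of% @hn]

end CategoryTheory.Adjunction

/-- Let `F ⊣ G` and `F' ⊣ G'` be adjunctions `C ⇄ D` and `C ⇄ D'`, and suppose there is
an isomorphism `σ : G ∘ F ≅ G' ∘ F'` of the associated adjunction monads (an isomorphism
in the category of monads on `C`, compatible with the units and the multiplications
`G ε F` and `G' ε' F'`).  Then for every object `X` of `C` there is an isomorphism of
monoids `End_D(F X) ≅ End_{D'}(F' X)` between the endomorphism monoids under
composition. -/
theorem end_monoid_iso_of_adjunction_monad_iso
    {C D D' : Type*} [Category C] [Category D] [Category D']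
    (F : C ⥤ D) (G : D ⥤ C) (adj : F ⊣ G)
    (F' : C ⥤ D') (G' : D' ⥤ C) (adj' : F' ⊣ G')
    (σ : adj.toMonad ≅ adj'.toMonad) (X : C) :
    Nonempty (End (F.obj X) ≃* End (F'.obj X)) := by
  exact ⟨{ adj.homEquivOfMonadIso adj' σ X X with
    map_mul' := fun f g => Adjunction.homEquivOfMonadIso_comp adj adj' σ g f }⟩
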